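/- Let c1, c2 > 0 and l > 0 with 2l ≤ c2/√3. Then for every y ∈ ℝ with |y| ≤ 2l, the derivative of the PBQU satisfies f′(y) ≥ f′(2l). -/

import Mathlib

/-- The Piecewise Biased Quadratic Unit (PBQU) activation. -/
noncomputable def pbqu (c1 c2 : ℝ) (x : ℝ) : ℝ :=
  if x < 0 then c1 ^ 2 / (x ^ 2 + c1 ^ 2) else c2 ^ 2 / (x ^ 2 + c2 ^ 2)

lemma hasDerivAt_sq_div_sq_add_sq {c : ℝ} (hc : 0 < c) (x : ℝ) :
    HasDerivAt (fun t : ℝ => c ^ 2 / (t ^ 2 + c ^ 2)) (-2 * c ^ 2 * x / (x ^ 2 + c ^ 2) ^ 2) x := by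
  have h : HasDerivAt (fun t : ℝ => t ^ 2 + c ^ 2) (2 * x) x := by
    simpa using (hasDerivAt_pow 2 x).add_const (c ^ 2)
  refine ((hasDerivAt_const x (c ^ 2)).fun_div h (by positivity)).congr_deriv ?_
  ring

lemma deriv_pbqu_of_neg {c1 : ℝ} (c2 : ℝ) (hc1 : 0 < c1) {x : ℝ} (hx : x < 0) :
    deriv (pbqu c1 c2) x = -2 * c1 ^ 2 * x / (x ^ 2 + c1 ^ 2) ^ 2 := by
  refine ((hasDerivAt_sq_div_sq_add_sq hc1 x).congr_of_eventuallyEq ?_).deriv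
  filter_upwards [Iio_mem_nhds hx] with t ht
  exact if_pos ht

lemma deriv_pbqu_of_pos (c1 : ℝ) {c2 : ℝ} (hc2 : 0 < c2) {x : ℝ} (hx : 0 < x) :
    deriv (pbqu c1 c2) x = -2 * c2 ^ 2 * x / (x ^ 2 + c2 ^ 2) ^ 2 := by
  refine ((hasDerivAt_sq_div_sq_add_sq hc2 x).congr_of_eventuallyEq ?_).deriv
  filter_upwards [Ioi_mem_nhds hx] with t ht
  exact if_neg (not_lt.mpr (le_of_lt ht))

lemma deriv_pbqu_zero {c1 c2 : ℝ} (hc1 : 0 < c1) (hc2 : 0 < c2) :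
    deriv (pbqu c1 c2) 0 = 0 := by
  refine IsLocalMax.deriv_eq_zero (Filter.Eventually.of_forall fun t => ?_)
  have h0 : pbqu c1 c2 0 = 1 := by simp [pbqu, hc2.ne']
  rw [h0, pbqu]
  split_ifs
  · exact (div_le_one (by positivity)).mpr (by nlinarith [sq_nonneg t])
  · exact (div_le_one (by positivity)).mpr (by nlinarith [sq_nonneg t])

lemma mul_sq_add_sq_sq_le {c m y : ℝ} (hy : 0 ≤ y) (hym : y ≤ m) (hm : 3 * m ^ 2 ≤ c ^ 2) :
    y * (m ^ 2 + c ^ 2) ^ 2 ≤ m * (y ^ 2 + c ^ 2) ^ 2 := by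
  have hmy : m * y ≤ m ^ 2 := by nlinarith
  have hmy0 : 0 ≤ m * y := mul_nonneg (hy.trans hym) hy
  have hyy : y ^ 2 ≤ m ^ 2 := by nlinarith
  have h1 : m * y * (m ^ 2 + m * y + y ^ 2) ≤ m ^ 2 * (3 * m ^ 2) :=
    mul_le_mul hmy (by linarith) (by positivity) (by positivity)
  have h2 : c ^ 2 * (m * y) ≤ c ^ 2 * m ^ 2 := mul_le_mul_of_nonneg_left hmy (sq_nonneg c)
  have h3 : 0 ≤ c ^ 4 - 2 * c ^ 2 * (m * y) - m * y * (m ^ 2 + m * y + y ^ 2) := by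
    nlinarith [mul_nonneg (sub_nonneg.mpr hm) (add_nonneg (sq_nonneg c) (sq_nonneg m))]
  nlinarith [mul_nonneg (sub_nonneg.mpr hym) h3]

theorem stmt_7 (c1 c2 l : ℝ) (hc1 : 0 < c1) (hc2 : 0 < c2) (hl : 0 < l)
    (h2l : 2 * l ≤ c2 / Real.sqrt 3) :
    ∀ y : ℝ, |y| ≤ 2 * l → deriv (pbqu c1 c2) (2 * l) ≤ deriv (pbqu c1 c2) y := by
  intro y hy
  have hm : 0 < 2 * l := by linarith
  have hsq : 3 * (2 * l) ^ 2 ≤ c2 ^ 2 := by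
    have h := (le_div_iff₀ (by positivity)).mp h2l
    have h' := pow_le_pow_left₀ (by positivity) h 2
    rw [mul_pow, Real.sq_sqrt (by norm_num)] at h'
    linarith
  have hneg : -2 * c2 ^ 2 * (2 * l) / ((2 * l) ^ 2 + c2 ^ 2) ^ 2 ≤ 0 :=
    div_nonpos_of_nonpos_of_nonneg (by nlinarith [mul_pos (pow_pos hc2 2) hm]) (by positivity)
  rw [deriv_pbqu_of_pos c1 hc2 hm]
  rcases lt_trichotomy y 0 with h | rfl | h
  · rw [deriv_pbqu_of_neg c2 hc1 h]
    refine hneg.trans (div_nonneg ?_ (by positivity))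
    nlinarith [mul_pos (pow_pos hc1 2) (neg_pos.mpr h)]
  · rwa [deriv_pbqu_zero hc1 hc2]
  · rw [deriv_pbqu_of_pos c1 hc2 h, div_le_div_iff₀ (by positivity) (by positivity)]
    have key := mul_sq_add_sq_sq_le h.le ((le_abs_self y).trans hy) hsq
    nlinarith [mul_le_mul_of_nonneg_left key (sq_nonneg c2)]
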